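/- For every x ∈ X, the family {π_Λ(·|x)}_{Λ ∈ 𝔏_fin} of probability measures on X (indexed by the finite non-void subsets Λ of L, directed by inclusion) is relatively compact in the weak topology of probability measures on X, and every accumulation point of this family is a Euclidean Gibbs measure; consequently the set 𝒢(v) of Euclidean Gibbs measures is non-void. -/

import Mathlib

open MeasureTheory

noncomputable section

/-- The loop space over `M`: continuous paths on `[0,1]` with equal endpoints,
with the supremum metric. -/
def Loop (M : Type*) [TopologicalSpace M] : Type _ :=
  {x : C(unitInterval, M) // x 0 = x 1}

variable {M : Type*} [MetricSpace M]

instance : MetricSpace (Loop M) :=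
  inferInstanceAs (MetricSpace {x : C(unitInterval, M) // x 0 = x 1})

instance : MeasurableSpace (Loop M) := borel _

instance : BorelSpace (Loop M) := ⟨rfl⟩

/-- The underlying continuous path of a loop. -/
def Loop.path : Loop M → C(unitInterval, M) := Subtype.val

/-- `V(x,y) = ∫₀¹ v(x(τ), y(τ)) dτ`, the time-averaged pair interaction. -/
def pathV (v : C(M × M, ℝ)) (x y : Loop M) : ℝ :=
  ∫ τ : unitInterval, v (x.path τ, y.path τ)

variable {L : Type*} [DecidableEq L] (G : SimpleGraph L) [DecidableRel G.Adj]
  [G.LocallyFinite] (χ : L → Measure (Loop M)) (v : L → L → C(M × M, ℝ))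

/-- The configuration `x_Λ × y_{Λᶜ}`. -/
def Finset.glue (Λ : Finset L) (x : Λ → Loop M) (y : (ℓ : L) → Loop M) (ℓ : L) : Loop M :=
  if h : ℓ ∈ Λ then x ⟨ℓ, h⟩ else y ℓ

/-- The product measure `χ_Λ = ⊗_{ℓ ∈ Λ} χ_ℓ`. -/
def chiProd (Λ : Finset L) : Measure (Λ → Loop M) :=
  Measure.pi fun ℓ : Λ => χ ℓ

/-- `V_Λ(x_Λ | y)`: interaction energy of `x_Λ` inside `Λ` plus its interaction with
the boundary condition `y` outside `Λ`.  (Each unordered interior edge is counted twice in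
the double sum, whence the factor 1/2.) -/
def condV (Λ : Finset L) (x : Λ → Loop M) (y : (ℓ : L) → Loop M) : ℝ :=
  (1 / 2) * ∑ ℓ : Λ, ∑ ℓ' : Λ,
      (if G.Adj ℓ ℓ' then pathV (v ℓ ℓ') (x ℓ) (x ℓ') else 0)
    + ∑ ℓ : Λ, ∑ ℓ' ∈ G.neighborFinset (ℓ : L) \ Λ, pathV (v ℓ ℓ') (x ℓ) (y ℓ')

/-- The local Gibbs kernel `π_Λ(dx | y)` as a measure on configuration space. -/
def gibbsKernel (Λ : Finset L) (y : (ℓ : L) → Loop M) : Measure ((ℓ : L) → Loop M) :=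
  (∫⁻ x, ENNReal.ofReal (Real.exp (condV G v Λ x y)) ∂chiProd χ Λ)⁻¹ •
    Measure.map (fun x => Finset.glue Λ x y)
      ((chiProd χ Λ).withDensity fun x => ENNReal.ofReal (Real.exp (condV G v Λ x y)))

/-- `μ` is a Euclidean Gibbs measure: a probability measure satisfying the DLR equation
`μ(B) = ∫ π_Λ(B|x) μ(dx)` for every finite non-void `Λ`. -/
def IsGibbs (μ : Measure ((ℓ : L) → Loop M)) : Prop :=
  IsProbabilityMeasure μ ∧
    ∀ Λ : Finset L, Λ.Nonempty → μ.bind (gibbsKernel G χ v Λ) = μ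

end

noncomputable section

instance {M : Type*} [MetricSpace M] [CompactSpace M] : SecondCountableTopology (Loop M) :=
  inferInstanceAs (SecondCountableTopology {x : C(unitInterval, M) // x 0 = x 1})

open Filter Topology Function
open scoped ENNReal NNReal BoundedContinuousFunction

section Tightness

variable {ι : Type*} {Y : ι → Type*} [∀ i, TopologicalSpace (Y i)] [∀ i, MeasurableSpace (Y i)]

/-- A family of measures on a countable product is tight if all its one-coordinate marginals
are tight. -/
theorem isTightMeasureSet_of_forall_map_eval [Countable ι] {S : Set (Measure ((i : ι) → Y i))}
    (h : ∀ i, IsTightMeasureSet ((fun μ : Measure ((i : ι) → Y i) => μ.map (eval i)) '' S)) :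
    IsTightMeasureSet S := by
  rw [isTightMeasureSet_iff_exists_isCompact_measure_compl_le]
  intro ε hε
  obtain ⟨δ, hδ, hsum⟩ := ENNReal.exists_pos_sum_of_countable' hε.ne' ι
  have hK : ∀ i, ∃ K : Set (Y i), IsCompact K ∧ ∀ μ ∈ S, μ.map (eval i) Kᶜ ≤ δ i := by
    intro i
    obtain ⟨K, hK, hle⟩ :=
      isTightMeasureSet_iff_exists_isCompact_measure_compl_le.1 (h i) (δ i) (hδ i)
    exact ⟨K, hK, fun μ hμ => hle _ ⟨μ, hμ, rfl⟩⟩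
  choose K hKc hKle using hK
  refine ⟨Set.pi Set.univ K, isCompact_univ_pi hKc, fun μ hμ => ?_⟩
  have hsub : (Set.pi Set.univ K)ᶜ ⊆ ⋃ i, eval i ⁻¹' (K i)ᶜ := by
    intro z hz
    simpa [Set.mem_pi] using hz
  calc μ (Set.pi Set.univ K)ᶜ ≤ ∑' i, μ (eval i ⁻¹' (K i)ᶜ) :=
        (measure_mono hsub).trans (measure_iUnion_le _)
    _ ≤ ∑' i, δ i := by
        gcongr with i
        exact (Measure.le_map_apply (measurable_pi_apply i).aemeasurable _).trans (hKle i μ hμ)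
    _ ≤ ε := hsum.le

theorem isTightMeasureSet_of_forall_le {α : Type*} [TopologicalSpace α] [MeasurableSpace α]
    {S : Set (Measure α)} {ν : Measure α} (hν : IsTightMeasureSet {ν}) (h : ∀ μ ∈ S, μ ≤ ν) :
    IsTightMeasureSet S := by
  rw [isTightMeasureSet_iff_exists_isCompact_measure_compl_le] at hν ⊢
  intro ε hε
  obtain ⟨K, hK, hle⟩ := hν ε hε
  exact ⟨K, hK, fun μ hμ => (h μ hμ _).trans (hle ν rfl)⟩

end Tightness

section Marginal

variable {ι : Type*} [DecidableEq ι] {Y : ι → Type*} [∀ i, MeasurableSpace (Y i)]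
  (χ : (i : ι) → Measure (Y i))

/-- A factor that does not depend on the coordinates in `s` can be pulled out of a marginal. -/
theorem lmarginal_mul_of_updateFinset [∀ i, SigmaFinite (χ i)]
    (s : Finset ι) {g h : ((i : ι) → Y i) → ℝ≥0∞}
    (hh : Measurable h) (hg : ∀ z y, g (updateFinset z s y) = g z) (z : (i : ι) → Y i) :
    lmarginal χ s (fun z => g z * h z) z = g z * lmarginal χ s h z := by
  simp only [lmarginal, hg]
  exact lintegral_const_mul _ (hh.comp measurable_updateFinset)

theorem lmarginal_updateFinset (s : Finset ι) (h : ((i : ι) → Y i) → ℝ≥0∞)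
    (z : (i : ι) → Y i) (y : (i : s) → Y i) :
    lmarginal χ s h (updateFinset z s y) = lmarginal χ s h z :=
  lmarginal_congr χ h fun i hi => by simp [updateFinset, hi]

theorem lmarginal_const [∀ i, IsProbabilityMeasure (χ i)] (s : Finset ι) (c : ℝ≥0∞)
    (z : (i : ι) → Y i) : lmarginal χ s (fun _ => c) z = c := by
  simp [lmarginal]

/-- Marginals of bounded continuous functions are continuous. -/
theorem continuous_lmarginal [Countable ι] [∀ i, TopologicalSpace (Y i)]
    [∀ i, FirstCountableTopology (Y i)] [∀ i, IsProbabilityMeasure (χ i)] (s : Finset ι)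
    {h : ((i : ι) → Y i) → ℝ≥0∞} (hm : Measurable h) (hc : Continuous h) {C : ℝ≥0∞}
    (hC : C ≠ ∞) (hle : ∀ z, h z ≤ C) : Continuous (lmarginal χ s h) := by
  rw [continuous_iff_continuousAt]
  intro z
  refine tendsto_lintegral_filter_of_dominated_convergence (fun _ => C)
    (Eventually.of_forall fun z' => hm.comp measurable_updateFinset)
    (Eventually.of_forall fun z' => Eventually.of_forall fun y => hle _) (by simpa using hC)
    (Eventually.of_forall fun y => ?_)
  have hu : Continuous fun z' : (i : ι) → Y i => updateFinset z' s y := by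
    refine continuous_pi fun i => ?_
    by_cases hi : i ∈ s
    · simp only [updateFinset, hi, dif_pos]
      exact continuous_const
    · simp only [updateFinset, hi, dif_neg, not_false_eq_true]
      exact continuous_apply i
  exact (hc.comp hu).tendsto z

end Marginal

section PairSums

/-- The pair energy of `Λ` inside a larger set `U`, counting every edge meeting `Λ` once, is the
total energy of `U` minus the energy of `U \ Λ`. -/
theorem half_sum_add_sum_sdiff {ι : Type*} [DecidableEq ι] (a : ι → ι → ℝ)
    (ha : ∀ i j, a i j = a j i) {s u : Finset ι} (h : s ⊆ u) :
    (1 / 2) * ∑ i ∈ s, ∑ j ∈ s, a i j + ∑ i ∈ s, ∑ j ∈ u \ s, a i j =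
      (1 / 2) * ∑ i ∈ u, ∑ j ∈ u, a i j - (1 / 2) * ∑ i ∈ u \ s, ∑ j ∈ u \ s, a i j := by
  have hcomm : ∑ i ∈ u \ s, ∑ j ∈ s, a i j = ∑ i ∈ s, ∑ j ∈ u \ s, a i j := by
    rw [Finset.sum_comm]
    simp only [ha]
  have hu : ∑ i ∈ u, ∑ j ∈ u, a i j = (∑ i ∈ u \ s, ∑ j ∈ u \ s, a i j +
      ∑ i ∈ u \ s, ∑ j ∈ s, a i j) + (∑ i ∈ s, ∑ j ∈ u \ s, a i j + ∑ i ∈ s, ∑ j ∈ s, a i j) := by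
    rw [← Finset.sum_sdiff h, ← Finset.sum_add_distrib, ← Finset.sum_add_distrib]
    simp only [Finset.sum_sdiff h]
  linarith

end PairSums

section Interaction

variable {M : Type*} [MetricSpace M]

instance [CompactSpace M] : CompleteSpace (Loop M) := by
  have hclosed : IsClosed {x : C(unitInterval, M) | x 0 = x 1} :=
    isClosed_eq (continuous_eval_const 0) (continuous_eval_const 1)
  exact hclosed.completeSpace_coe

theorem pathV_comm {v w : C(M × M, ℝ)} (h : ∀ ξ η : M, v (ξ, η) = w (η, ξ)) (x y : Loop M) :
    pathV v x y = pathV w y x := by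
  simp only [pathV, h]

variable [CompactSpace M]

theorem abs_pathV_le (v : C(M × M, ℝ)) (x y : Loop M) : |pathV v x y| ≤ ‖v‖ := by
  have h := norm_integral_le_of_norm_le_const (μ := (volume : Measure unitInterval))
    (f := fun τ => v (x.path τ, y.path τ)) (Eventually.of_forall fun τ => v.norm_coe_le_norm _)
  simpa [pathV] using h

theorem continuous_pathV (v : C(M × M, ℝ)) :
    Continuous fun p : Loop M × Loop M => pathV v p.1 p.2 := by
  refine continuous_of_dominated (bound := fun _ => ‖v‖) (fun p => ?_)
    (fun p => Eventually.of_forall fun τ => v.norm_coe_le_norm _) (integrable_const _)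
    (Eventually.of_forall fun τ => ?_)
  · exact (v.continuous.comp
      (p.1.path.continuous.prodMk p.2.path.continuous)).aestronglyMeasurable
  · have hp : Continuous fun x : Loop M => x.path τ :=
      (continuous_eval_const (F := C(unitInterval, M)) τ).comp continuous_subtype_val
    exact v.continuous.comp ((hp.comp continuous_fst).prodMk (hp.comp continuous_snd))

end Interaction

section PairEnergy

variable {M : Type*} [MetricSpace M] {L : Type*} (G : SimpleGraph L) [DecidableRel G.Adj]
  (v : L → L → C(M × M, ℝ))

/-- The interaction of an ordered pair of sites, zero unless they are adjacent. -/
def pairEnergy (z : (ℓ : L) → Loop M) (ℓ ℓ' : L) : ℝ :=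
  if G.Adj ℓ ℓ' then pathV (v ℓ ℓ') (z ℓ) (z ℓ') else 0

variable {v} in
theorem pairEnergy_comm (hvsymm : ∀ ℓ ℓ', v ℓ ℓ' = v ℓ' ℓ)
    (hvsymm' : ∀ ℓ ℓ' (ξ η : M), v ℓ ℓ' (ξ, η) = v ℓ ℓ' (η, ξ)) (z : (ℓ : L) → Loop M)
    (ℓ ℓ' : L) : pairEnergy G v z ℓ ℓ' = pairEnergy G v z ℓ' ℓ := by
  unfold pairEnergy
  rw [pathV_comm (w := v ℓ' ℓ) fun ξ η => by rw [hvsymm' ℓ ℓ', hvsymm ℓ ℓ']]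
  simp only [G.adj_comm ℓ ℓ']

end PairEnergy

section Energy

variable {M : Type*} [MetricSpace M] {L : Type*} [DecidableEq L] (G : SimpleGraph L)
  [DecidableRel G.Adj] [G.LocallyFinite] (v : L → L → C(M × M, ℝ))

/-- The energy of the edges meeting `Λ` in the configuration `z`. -/
def energy (Λ : Finset L) (z : (ℓ : L) → Loop M) : ℝ :=
  condV G v Λ (fun ℓ => z ℓ) z

theorem glue_eq_updateFinset (Λ : Finset L) (x : Λ → Loop M) (y : (ℓ : L) → Loop M) :
    Λ.glue x y = updateFinset y Λ x := rfl

theorem condV_eq_energy (Λ : Finset L) (x : Λ → Loop M) (y : (ℓ : L) → Loop M) :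
    condV G v Λ x y = energy G v Λ (updateFinset y Λ x) := by
  have hin : (fun ℓ : Λ => updateFinset y Λ x ℓ) = x := by
    funext ℓ
    simp [updateFinset]
  rw [energy, hin]
  unfold condV
  congr 1
  refine Finset.sum_congr rfl fun ℓ _ => Finset.sum_congr rfl fun ℓ' hℓ' => ?_
  simp [updateFinset, (Finset.mem_sdiff.1 hℓ').2]

theorem energy_eq_sum (Λ U : Finset L) (hU : ∀ ℓ ∈ Λ, G.neighborFinset ℓ ⊆ U)
    (z : (ℓ : L) → Loop M) :
    energy G v Λ z = (1 / 2) * ∑ ℓ ∈ Λ, ∑ ℓ' ∈ Λ, pairEnergy G v z ℓ ℓ' +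
      ∑ ℓ ∈ Λ, ∑ ℓ' ∈ U \ Λ, pairEnergy G v z ℓ ℓ' := by
  unfold energy condV
  congr 1
  · rw [← Finset.sum_coe_sort Λ]
    congr 1
    refine Finset.sum_congr rfl fun ℓ _ => ?_
    rw [← Finset.sum_coe_sort Λ]
    rfl
  · rw [← Finset.sum_coe_sort Λ]
    refine Finset.sum_congr rfl fun ℓ _ => ?_
    rw [← Finset.sum_subset (Finset.sdiff_subset_sdiff (hU ℓ ℓ.2) subset_rfl)]
    · refine Finset.sum_congr rfl fun ℓ' hℓ' => ?_
      have hadj : G.Adj ℓ ℓ' := by simpa using (Finset.mem_sdiff.1 hℓ').1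
      simp [pairEnergy, hadj]
    · intro ℓ' hℓ' hnot
      have hadj : ¬ G.Adj ℓ ℓ' := by
        intro hadj
        exact hnot (Finset.mem_sdiff.2 ⟨by simpa using hadj, (Finset.mem_sdiff.1 hℓ').2⟩)
      simp [pairEnergy, hadj]

variable {v} in
/-- For `Δ ⊆ Λ` the difference of the energies of `Λ` and `Δ` does not depend on the
configuration in `Δ`. -/
theorem energy_sub_energy_updateFinset (hvsymm : ∀ ℓ ℓ', v ℓ ℓ' = v ℓ' ℓ)
    (hvsymm' : ∀ ℓ ℓ' (ξ η : M), v ℓ ℓ' (ξ, η) = v ℓ ℓ' (η, ξ)) {Δ Λ : Finset L} (h : Δ ⊆ Λ)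
    (z : (ℓ : L) → Loop M) (y : Δ → Loop M) :
    energy G v Λ (updateFinset z Δ y) - energy G v Δ (updateFinset z Δ y) =
      energy G v Λ z - energy G v Δ z := by
  set U := Λ ∪ Λ.biUnion fun ℓ => G.neighborFinset ℓ with hUdef
  have hΛU : Λ ⊆ U := Finset.subset_union_left
  have hU : ∀ ℓ ∈ Λ, G.neighborFinset ℓ ⊆ U := fun ℓ hℓ =>
    (Finset.subset_biUnion_of_mem (fun ℓ => G.neighborFinset ℓ) hℓ).trans
      Finset.subset_union_right
  have key : ∀ z : (ℓ : L) → Loop M, energy G v Λ z - energy G v Δ z =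
      (1 / 2) * ∑ ℓ ∈ U \ Δ, ∑ ℓ' ∈ U \ Δ, pairEnergy G v z ℓ ℓ' -
        (1 / 2) * ∑ ℓ ∈ U \ Λ, ∑ ℓ' ∈ U \ Λ, pairEnergy G v z ℓ ℓ' := by
    intro z
    have hs := pairEnergy_comm G hvsymm hvsymm' z
    rw [energy_eq_sum G v Λ U hU, energy_eq_sum G v Δ U fun ℓ hℓ => hU ℓ (h hℓ),
      half_sum_add_sum_sdiff _ hs hΛU, half_sum_add_sum_sdiff _ hs (h.trans hΛU)]
    ring
  have hoff : ∀ s : Finset L, Δ ⊆ s → ∑ ℓ ∈ U \ s, ∑ ℓ' ∈ U \ s,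
      pairEnergy G v (updateFinset z Δ y) ℓ ℓ' =
        ∑ ℓ ∈ U \ s, ∑ ℓ' ∈ U \ s, pairEnergy G v z ℓ ℓ' := by
    intro s hs
    refine Finset.sum_congr rfl fun ℓ hℓ => Finset.sum_congr rfl fun ℓ' hℓ' => ?_
    have h₁ : ℓ ∉ Δ := fun hm => (Finset.mem_sdiff.1 hℓ).2 (hs hm)
    have h₂ : ℓ' ∉ Δ := fun hm => (Finset.mem_sdiff.1 hℓ').2 (hs hm)
    simp [pairEnergy, updateFinset, h₁, h₂]
  rw [key, key, hoff Δ subset_rfl, hoff Λ h]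

variable [CompactSpace M]

theorem exists_abs_energy_le (Λ : Finset L) :
    ∃ C : ℝ, ∀ z : (ℓ : L) → Loop M, |energy G v Λ z| ≤ C := by
  refine ⟨(1 / 2) * ∑ ℓ : Λ, ∑ ℓ' : Λ, ‖v ℓ ℓ'‖ +
    ∑ ℓ : Λ, ∑ ℓ' ∈ G.neighborFinset (ℓ : L) \ Λ, ‖v ℓ ℓ'‖, fun z => ?_⟩
  unfold energy condV
  refine (abs_add_le _ _).trans (add_le_add ?_ ?_)
  · rw [abs_mul, abs_of_pos (by norm_num : (0 : ℝ) < 1 / 2)]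
    gcongr
    refine (Finset.abs_sum_le_sum_abs _ _).trans (Finset.sum_le_sum fun ℓ _ => ?_)
    refine (Finset.abs_sum_le_sum_abs _ _).trans (Finset.sum_le_sum fun ℓ' _ => ?_)
    split_ifs
    · exact abs_pathV_le _ _ _
    · simp
  · refine (Finset.abs_sum_le_sum_abs _ _).trans (Finset.sum_le_sum fun ℓ _ => ?_)
    exact (Finset.abs_sum_le_sum_abs _ _).trans
      (Finset.sum_le_sum fun ℓ' _ => abs_pathV_le _ _ _)

theorem continuous_energy (Λ : Finset L) :
    Continuous fun z : (ℓ : L) → Loop M => energy G v Λ z := by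
  have hp : ∀ ℓ ℓ', Continuous fun z : (ℓ : L) → Loop M => pathV (v ℓ ℓ') (z ℓ) (z ℓ') :=
    fun ℓ ℓ' => by
      have hpair : Continuous fun z : (ℓ : L) → Loop M => (z ℓ, z ℓ') :=
        (continuous_apply ℓ).prodMk (continuous_apply ℓ')
      exact (continuous_pathV (v ℓ ℓ')).comp hpair
  unfold energy condV
  refine (continuous_const.mul (continuous_finsetSum _ fun ℓ _ =>
    continuous_finsetSum _ fun ℓ' _ => ?_)).add
    (continuous_finsetSum _ fun ℓ _ => continuous_finsetSum _ fun ℓ' _ => hp ℓ ℓ')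
  split_ifs
  · exact hp ℓ ℓ'
  · exact continuous_const

end Energy

section Kernel

variable {M : Type*} [MetricSpace M] {L : Type*} [DecidableEq L] (G : SimpleGraph L)
  [DecidableRel G.Adj] [G.LocallyFinite] (χ : L → Measure (Loop M)) (v : L → L → C(M × M, ℝ))

/-- The Boltzmann weight of the edges meeting `Λ`. -/
def weight (Λ : Finset L) (z : (ℓ : L) → Loop M) : ℝ≥0∞ :=
  ENNReal.ofReal (Real.exp (energy G v Λ z))

/-- The average of `f` with respect to the local Gibbs kernel, in terms of marginals. -/
def gibbsAverage (Λ : Finset L) (f : ((ℓ : L) → Loop M) → ℝ≥0∞) (y : (ℓ : L) → Loop M) : ℝ≥0∞ :=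
  (lmarginal χ Λ (weight G v Λ) y)⁻¹ * lmarginal χ Λ (fun z => f z * weight G v Λ z) y

theorem gibbsAverage_updateFinset (Λ : Finset L) (f : ((ℓ : L) → Loop M) → ℝ≥0∞)
    (z : (ℓ : L) → Loop M) (y : Λ → Loop M) :
    gibbsAverage G χ v Λ f (updateFinset z Λ y) = gibbsAverage G χ v Λ f z := by
  simp only [gibbsAverage, lmarginal_updateFinset]

theorem gibbsAverage_le (Λ : Finset L) {f : ((ℓ : L) → Loop M) → ℝ≥0∞} {C : ℝ≥0∞}
    (hf : ∀ z, f z ≤ C) (hC : C ≠ ∞) (y : (ℓ : L) → Loop M) : gibbsAverage G χ v Λ f y ≤ C := by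
  have h : lmarginal χ Λ (fun z => f z * weight G v Λ z) y ≤
      C * lmarginal χ Λ (weight G v Λ) y := by
    simp only [lmarginal]
    rw [← lintegral_const_mul' _ _ hC]
    gcongr
    exact hf _
  rw [gibbsAverage, mul_comm, ← div_eq_mul_inv]
  exact ENNReal.div_le_of_le_mul h

variable [CompactSpace M]

theorem exists_weight_bounds (Λ : Finset L) :
    ∃ a b : ℝ≥0∞, a ≠ 0 ∧ b ≠ ∞ ∧
      ∀ z : (ℓ : L) → Loop M, a ≤ weight G v Λ z ∧ weight G v Λ z ≤ b := by
  obtain ⟨C, hC⟩ := exists_abs_energy_le G v Λ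
  refine ⟨ENNReal.ofReal (Real.exp (-C)), ENNReal.ofReal (Real.exp C), ?_, ENNReal.ofReal_ne_top,
    fun z => ⟨?_, ?_⟩⟩
  · simpa using Real.exp_pos _
  · exact ENNReal.ofReal_le_ofReal (Real.exp_le_exp.2 (abs_le.1 (hC z)).1)
  · exact ENNReal.ofReal_le_ofReal (Real.exp_le_exp.2 (abs_le.1 (hC z)).2)

theorem continuous_weight (Λ : Finset L) :
    Continuous fun z : (ℓ : L) → Loop M => weight G v Λ z :=
  ENNReal.continuous_ofReal.comp (Real.continuous_exp.comp (continuous_energy G v Λ))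

theorem measurable_weight [Countable L] (Λ : Finset L) :
    Measurable fun z : (ℓ : L) → Loop M => weight G v Λ z :=
  (continuous_weight G v Λ).measurable

theorem lintegral_gibbsKernel [Countable L] (Λ : Finset L)
    {f : ((ℓ : L) → Loop M) → ℝ≥0∞} (hf : Measurable f) (y : (ℓ : L) → Loop M) :
    ∫⁻ z, f z ∂gibbsKernel G χ v Λ y = gibbsAverage G χ v Λ f y := by
  have hu : Measurable fun x : Λ → Loop M => updateFinset y Λ x := measurable_updateFinset
  unfold gibbsKernel
  have hweight : ∀ z, ENNReal.ofReal (Real.exp (energy G v Λ z)) = weight G v Λ z := fun _ => rfl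
  simp only [glue_eq_updateFinset, condV_eq_energy, hweight]
  rw [lintegral_smul_measure, lintegral_map hf hu,
    lintegral_withDensity_eq_lintegral_mul _ (f := fun x => weight G v Λ (updateFinset y Λ x))
      ((measurable_weight G v Λ).comp hu) (g := fun x => f (updateFinset y Λ x)) (hf.comp hu)]
  simp only [gibbsAverage, lmarginal, smul_eq_mul, Pi.mul_apply, mul_comm, chiProd]

variable [∀ ℓ, IsProbabilityMeasure (χ ℓ)]

theorem lmarginal_weight_ne_zero (Λ : Finset L) (y : (ℓ : L) → Loop M) :
    lmarginal χ Λ (weight G v Λ) y ≠ 0 := by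
  obtain ⟨a, b, ha, hb, hab⟩ := exists_weight_bounds G v Λ
  have h : lmarginal χ Λ (fun _ => a) y ≤ lmarginal χ Λ (weight G v Λ) y :=
    lmarginal_mono (fun z => (hab z).1) y
  rw [lmarginal_const] at h
  exact (ha.bot_lt.trans_le h).ne'

theorem lmarginal_weight_ne_top (Λ : Finset L) (y : (ℓ : L) → Loop M) :
    lmarginal χ Λ (weight G v Λ) y ≠ ∞ := by
  obtain ⟨a, b, ha, hb, hab⟩ := exists_weight_bounds G v Λ
  have h : lmarginal χ Λ (weight G v Λ) y ≤ lmarginal χ Λ (fun _ => b) y :=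
    lmarginal_mono (fun z => (hab z).2) y
  rw [lmarginal_const] at h
  exact (h.trans_lt hb.lt_top).ne

/-- The single-site kernels are dominated by multiples of the reference measures, uniformly in
the boundary condition. -/
theorem exists_gibbsAverage_singleton_le (ℓ : L) :
    ∃ c : ℝ≥0∞, c ≠ ∞ ∧ ∀ A : Set (Loop M), MeasurableSet A → ∀ z : (ℓ : L) → Loop M,
      gibbsAverage G χ v {ℓ} ((eval ℓ ⁻¹' A).indicator 1) z ≤ c * χ ℓ A := by
  obtain ⟨a, b, ha, hb, hab⟩ := exists_weight_bounds G v {ℓ}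
  refine ⟨a⁻¹ * b, ENNReal.mul_ne_top (ENNReal.inv_ne_top.2 ha) hb, fun A hA z => ?_⟩
  have hZ : lmarginal χ {ℓ} (fun _ => a) z ≤ lmarginal χ {ℓ} (weight G v {ℓ}) z :=
    lmarginal_mono (fun z => (hab z).1) z
  rw [lmarginal_const] at hZ
  have hind : ∀ u, (eval ℓ ⁻¹' A).indicator (1 : ((ℓ : L) → Loop M) → ℝ≥0∞) (update z ℓ u) =
      A.indicator 1 u := fun u => by
    classical simp [Set.indicator_apply]
  have hN : lmarginal χ {ℓ} (fun z => (eval ℓ ⁻¹' A).indicator 1 z * weight G v {ℓ} z) z ≤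
      b * χ ℓ A := by
    rw [lmarginal_singleton, ← lintegral_indicator_one hA, ← lintegral_const_mul' _ _ hb]
    refine lintegral_mono fun u => ?_
    dsimp only
    rw [hind, mul_comm]
    exact mul_le_mul' (hab _).2 le_rfl
  rw [mul_assoc]
  exact mul_le_mul' (ENNReal.inv_le_inv.2 hZ) hN

variable [Countable L]

theorem measurable_gibbsAverage (Λ : Finset L) {f : ((ℓ : L) → Loop M) → ℝ≥0∞}
    (hf : Measurable f) : Measurable (gibbsAverage G χ v Λ f) :=
  ((measurable_weight G v Λ).lmarginal χ).inv.mul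
    ((hf.mul (measurable_weight G v Λ)).lmarginal χ)

instance isProbabilityMeasure_gibbsKernel (Λ : Finset L) (y : (ℓ : L) → Loop M) :
    IsProbabilityMeasure (gibbsKernel G χ v Λ y) := by
  refine ⟨?_⟩
  rw [← lintegral_one, lintegral_gibbsKernel G χ v Λ measurable_const, gibbsAverage]
  simp only [one_mul]
  exact ENNReal.inv_mul_cancel (lmarginal_weight_ne_zero G χ v Λ y)
    (lmarginal_weight_ne_top G χ v Λ y)

theorem measurable_gibbsKernel (Λ : Finset L) : Measurable (gibbsKernel G χ v Λ) := by
  refine Measure.measurable_of_measurable_coe _ fun s hs => ?_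
  have h : (fun y => gibbsKernel G χ v Λ y s) = gibbsAverage G χ v Λ (s.indicator 1) := by
    funext y
    rw [← lintegral_gibbsKernel G χ v Λ (measurable_one.indicator hs), lintegral_indicator_one hs]
  rw [h]
  exact measurable_gibbsAverage G χ v Λ (measurable_one.indicator hs)

variable {v} in
/-- Consistency of the local Gibbs kernels. -/
theorem lintegral_gibbsAverage (hvsymm : ∀ ℓ ℓ', v ℓ ℓ' = v ℓ' ℓ)
    (hvsymm' : ∀ ℓ ℓ' (ξ η : M), v ℓ ℓ' (ξ, η) = v ℓ ℓ' (η, ξ)) {Δ Λ : Finset L} (h : Δ ⊆ Λ)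
    {f : ((ℓ : L) → Loop M) → ℝ≥0∞} (hf : Measurable f) (y : (ℓ : L) → Loop M) :
    ∫⁻ z, gibbsAverage G χ v Δ f z ∂gibbsKernel G χ v Λ y = ∫⁻ z, f z ∂gibbsKernel G χ v Λ y := by
  have hw := measurable_weight G v Δ
  have hwΛ := measurable_weight G v Λ
  have hA := measurable_gibbsAverage G χ v Δ hf
  have hunion : ∀ {q : ((ℓ : L) → Loop M) → ℝ≥0∞}, Measurable q →
      lmarginal χ Λ q = lmarginal χ (Λ \ Δ) (lmarginal χ Δ q) := fun hq => by
    rw [← lmarginal_union χ _ hq Finset.sdiff_disjoint, Finset.sdiff_union_of_subset h]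
  rw [lintegral_gibbsKernel G χ v Λ hA, lintegral_gibbsKernel G χ v Λ hf, gibbsAverage,
    gibbsAverage, hunion (q := fun z => gibbsAverage G χ v Δ f z * weight G v Λ z)
      (hA.mul hwΛ), hunion (q := fun z => f z * weight G v Λ z) (hf.mul hwΛ)]
  congr 2
  funext z
  set k : ((ℓ : L) → Loop M) → ℝ≥0∞ := fun z =>
    ENNReal.ofReal (Real.exp (energy G v Λ z - energy G v Δ z)) with hk
  have hkinv : ∀ z y, k (updateFinset z Δ y) = k z := fun z y => by
    simp only [hk, energy_sub_energy_updateFinset G hvsymm hvsymm' h]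
  have hsplit : ∀ z, weight G v Λ z = k z * weight G v Δ z := fun z => by
    simp only [hk, weight]
    rw [← ENNReal.ofReal_mul (Real.exp_pos _).le, ← Real.exp_add, sub_add_cancel]
  have h₁ : ∀ z, gibbsAverage G χ v Δ f z * weight G v Λ z =
      (gibbsAverage G χ v Δ f z * k z) * weight G v Δ z := fun z => by rw [hsplit, mul_assoc]
  have h₂ : ∀ z, f z * weight G v Λ z = k z * (f z * weight G v Δ z) := fun z => by
    rw [hsplit, mul_left_comm]
  simp only [h₁, h₂]
  rw [lmarginal_mul_of_updateFinset χ Δ hw fun z y => by rw [gibbsAverage_updateFinset, hkinv],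
    lmarginal_mul_of_updateFinset χ Δ (h := fun z => f z * weight G v Δ z) (hf.mul hw) hkinv,
    mul_comm _ (k z), mul_assoc]
  congr 1
  rw [gibbsAverage, mul_right_comm, ENNReal.inv_mul_cancel (lmarginal_weight_ne_zero G χ v Δ z)
    (lmarginal_weight_ne_top G χ v Δ z), one_mul]

/-- The Feller property of the local Gibbs kernels. -/
theorem continuous_gibbsAverage (Λ : Finset L) {f : ((ℓ : L) → Loop M) → ℝ≥0∞}
    (hf : Continuous f) {C : ℝ≥0∞} (hC : C ≠ ∞) (hle : ∀ z, f z ≤ C) :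
    Continuous (gibbsAverage G χ v Λ f) := by
  obtain ⟨a, b, ha, hb, hab⟩ := exists_weight_bounds G v Λ
  have hw := continuous_weight G v Λ
  have hfw : Continuous fun z => f z * weight G v Λ z := by
    rw [continuous_iff_continuousAt]
    intro z
    exact ENNReal.Tendsto.mul (hf.tendsto z) (Or.inr ((hab z).2.trans_lt hb.lt_top).ne)
      (hw.tendsto z) (Or.inr ((hle z).trans_lt hC.lt_top).ne)
  have hZ := continuous_lmarginal χ Λ hw.measurable hw hb fun z => (hab z).2
  have hN := continuous_lmarginal χ Λ hfw.measurable hfw (ENNReal.mul_ne_top hC hb)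
    fun z => mul_le_mul' (hle z) (hab z).2
  rw [continuous_iff_continuousAt]
  intro z
  have hNfin : lmarginal χ Λ (fun z => f z * weight G v Λ z) z ≠ ∞ := by
    have hN' : lmarginal χ Λ (fun z => f z * weight G v Λ z) z ≤
        lmarginal χ Λ (fun _ => C * b) z :=
      lmarginal_mono (fun z => mul_le_mul' (hle z) (hab z).2) z
    rw [lmarginal_const] at hN'
    exact (hN'.trans_lt (ENNReal.mul_ne_top hC hb).lt_top).ne
  exact ENNReal.Tendsto.mul ((hZ.inv).tendsto z) (Or.inr hNfin) (hN.tendsto z)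
    (Or.inr (ENNReal.inv_ne_top.2 (lmarginal_weight_ne_zero G χ v Λ z)))

variable {v} in
theorem isTightMeasureSet_range_gibbsKernel (hvsymm : ∀ ℓ ℓ', v ℓ ℓ' = v ℓ' ℓ)
    (hvsymm' : ∀ ℓ ℓ' (ξ η : M), v ℓ ℓ' (ξ, η) = v ℓ ℓ' (η, ξ)) (y : (ℓ : L) → Loop M) :
    IsTightMeasureSet (Set.range fun Λ => gibbsKernel G χ v Λ y) := by
  refine isTightMeasureSet_of_forall_map_eval fun ℓ => ?_
  obtain ⟨c, hc, hle⟩ := exists_gibbsAverage_singleton_le G χ v ℓ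
  have : IsFiniteMeasure (c • χ ℓ) := Measure.smul_finite _ hc
  refine isTightMeasureSet_of_forall_le (ν := c • χ ℓ + Measure.dirac (y ℓ))
    isTightMeasureSet_singleton ?_
  rintro _ ⟨_, ⟨Λ, rfl⟩, rfl⟩
  refine Measure.le_iff.2 fun A hA => ?_
  have hB : MeasurableSet (eval ℓ ⁻¹' A : Set ((ℓ : L) → Loop M)) := measurable_pi_apply ℓ hA
  have hf : Measurable ((eval ℓ ⁻¹' A).indicator (1 : ((ℓ : L) → Loop M) → ℝ≥0∞)) :=
    measurable_one.indicator hB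
  dsimp only
  rw [Measure.map_apply (measurable_pi_apply ℓ) hA, ← lintegral_indicator_one hB,
    Measure.add_apply]
  by_cases hℓ : ℓ ∈ Λ
  · refine le_add_right ?_
    rw [← lintegral_gibbsAverage G χ hvsymm hvsymm' (Finset.singleton_subset_iff.2 hℓ) hf]
    refine (lintegral_mono (hle A hA)).trans ?_
    simp
  · refine le_add_left ?_
    have hconst : ∀ z u, (eval ℓ ⁻¹' A).indicator (1 : ((ℓ : L) → Loop M) → ℝ≥0∞)
        (updateFinset z Λ u) = (eval ℓ ⁻¹' A).indicator 1 z := fun z u => by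
      classical simp [Set.indicator_apply, updateFinset, hℓ]
    rw [lintegral_gibbsKernel G χ v Λ hf, gibbsAverage,
      lmarginal_mul_of_updateFinset χ Λ (measurable_weight G v Λ) hconst, mul_left_comm,
      ENNReal.inv_mul_cancel (lmarginal_weight_ne_zero G χ v Λ y)
        (lmarginal_weight_ne_top G χ v Λ y), Measure.dirac_apply' _ hA]
    classical simp [Set.indicator_apply]

variable {v} in
/-- Weak limit points of the local Gibbs kernels are Gibbs measures. -/
theorem isGibbs_of_mapClusterPt (hvsymm : ∀ ℓ ℓ', v ℓ ℓ' = v ℓ' ℓ)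
    (hvsymm' : ∀ ℓ ℓ' (ξ η : M), v ℓ ℓ' (ξ, η) = v ℓ ℓ' (η, ξ)) (y : (ℓ : L) → Loop M)
    {F : Finset L → ProbabilityMeasure ((ℓ : L) → Loop M)}
    (hF : ∀ Λ, (F Λ : Measure ((ℓ : L) → Loop M)) = gibbsKernel G χ v Λ y)
    {μ : ProbabilityMeasure ((ℓ : L) → Loop M)} (hμ : MapClusterPt μ atTop F) :
    IsGibbs G χ v (μ : Measure ((ℓ : L) → Loop M)) := by
  refine ⟨inferInstance, fun Δ _ => ?_⟩
  have : IsProbabilityMeasure ((μ : Measure ((ℓ : L) → Loop M)).bind (gibbsKernel G χ v Δ)) :=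
    isProbabilityMeasure_bind (measurable_gibbsKernel G χ v Δ).aemeasurable
      (Eventually.of_forall fun z => inferInstance)
  refine ext_of_forall_lintegral_eq_of_IsFiniteMeasure fun f => ?_
  have hfc : Continuous fun z => (f z : ℝ≥0∞) := ENNReal.continuous_coe.comp f.continuous
  obtain ⟨C, hC⟩ : ∃ C : ℝ≥0, ∀ z, f z ≤ C :=
    ⟨nndist f 0, BoundedContinuousFunction.NNReal.upper_bound f⟩
  have hC' : ∀ z, (f z : ℝ≥0∞) ≤ C := fun z => ENNReal.coe_le_coe.2 (hC z)
  have hle := gibbsAverage_le G χ v Δ hC' ENNReal.coe_ne_top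
  have hne : ∀ z, gibbsAverage G χ v Δ (fun z => f z) z ≠ ∞ := fun z =>
    ((hle z).trans_lt ENNReal.coe_lt_top).ne
  have hcont := continuous_gibbsAverage G χ v Δ hfc ENNReal.coe_ne_top hC'
  have hbound : ∀ z, (gibbsAverage G χ v Δ (fun z => f z) z).toNNReal ≤ C := fun z =>
    ENNReal.coe_le_coe.1 (by rw [ENNReal.coe_toNNReal (hne z)]; exact hle z)
  let g : ((ℓ : L) → Loop M) →ᵇ ℝ≥0 := BoundedContinuousFunction.mkOfBound
    ⟨fun z => (gibbsAverage G χ v Δ (fun z => f z) z).toNNReal,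
      ENNReal.continuousOn_toNNReal.comp_continuous hcont hne⟩ C (fun z z' => by
        rw [NNReal.dist_eq, abs_le]
        have h₁ := NNReal.coe_le_coe.2 (hbound z)
        have h₂ := NNReal.coe_le_coe.2 (hbound z')
        simp only [ContinuousMap.coe_mk]
        constructor <;> linarith [NNReal.coe_nonneg
          (gibbsAverage G χ v Δ (fun z => f z) z).toNNReal, NNReal.coe_nonneg
          (gibbsAverage G χ v Δ (fun z => f z) z').toNNReal])
  have hg : ∀ z, (g z : ℝ≥0∞) = gibbsAverage G χ v Δ (fun z => f z) z := fun z =>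
    ENNReal.coe_toNNReal (hne z)
  have hclosed : IsClosed {ν : ProbabilityMeasure ((ℓ : L) → Loop M) |
      ν.toFiniteMeasure.testAgainstNN g = ν.toFiniteMeasure.testAgainstNN f} :=
    isClosed_eq (ProbabilityMeasure.continuous_testAgainstNN_eval g)
      (ProbabilityMeasure.continuous_testAgainstNN_eval f)
  have hmem := hclosed.mem_of_mapClusterPt hμ (by
    filter_upwards [eventually_ge_atTop Δ] with Λ hΛ
    refine congrArg ENNReal.toNNReal ?_
    simp only [ProbabilityMeasure.toFiniteMeasure, hF, hg]
    exact lintegral_gibbsAverage G χ hvsymm hvsymm' hΛ hfc.measurable y)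
  have hlim := congrArg (fun r : ℝ≥0 => (r : ℝ≥0∞)) hmem
  simp only [FiniteMeasure.testAgainstNN_coe_eq, hg] at hlim
  rw [Measure.lintegral_bind (measurable_gibbsKernel G χ v Δ).aemeasurable
    hfc.measurable.aemeasurable]
  simp only [lintegral_gibbsKernel G χ v Δ hfc.measurable]
  exact hlim

end Kernel

/-- For every boundary condition `x ∈ X`, the net `{π_Λ(·|x)}_{Λ ∈ 𝔏_fin}` (indexed by the
finite subsets of `L` directed by inclusion) is relatively compact in the weak topology of
probability measures on `X`, every accumulation point of it is a Euclidean Gibbs measure,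
and consequently the set `𝒢(v)` of Euclidean Gibbs measures is non-void. -/
theorem gibbsKernel_relatively_compact_and_cluster_points_gibbs
    {L : Type} [Countable L] [DecidableEq L]
    (G : SimpleGraph L) [DecidableRel G.Adj] [G.LocallyFinite]
    (M : Type) [MetricSpace M] [CompactSpace M]
    (χ : L → Measure (Loop M)) (hχ : ∀ ℓ, IsProbabilityMeasure (χ ℓ))
    (v : L → L → C(M × M, ℝ))
    (hvsymm : ∀ ℓ ℓ', v ℓ ℓ' = v ℓ' ℓ)
    (hvsymm' : ∀ ℓ ℓ' (ξ η : M), v ℓ ℓ' (ξ, η) = v ℓ ℓ' (η, ξ))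
    (x : (ℓ : L) → Loop M) :
    (∃ F : Finset L → ProbabilityMeasure ((ℓ : L) → Loop M),
      (∀ Λ : Finset L, (F Λ : Measure ((ℓ : L) → Loop M)) = gibbsKernel G χ v Λ x) ∧
      IsCompact (closure (Set.range F)) ∧
      ∀ μ : ProbabilityMeasure ((ℓ : L) → Loop M),
        MapClusterPt μ Filter.atTop F →
          IsGibbs G χ v (μ : Measure ((ℓ : L) → Loop M))) ∧
    ∃ μ : Measure ((ℓ : L) → Loop M), IsGibbs G χ v μ := by
  let F : Finset L → ProbabilityMeasure ((ℓ : L) → Loop M) :=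
    fun Λ => ⟨gibbsKernel G χ v Λ x, inferInstance⟩
  have hF : ∀ Λ, (F Λ : Measure ((ℓ : L) → Loop M)) = gibbsKernel G χ v Λ x := fun Λ => rfl
  have hcompact : IsCompact (closure (Set.range F)) := by
    refine isCompact_closure_of_isTightMeasureSet
      ((isTightMeasureSet_range_gibbsKernel G χ hvsymm hvsymm' x).subset ?_)
    rintro _ ⟨_, ⟨Λ, rfl⟩, rfl⟩
    exact ⟨Λ, rfl⟩
  have hgibbs : ∀ μ, MapClusterPt μ atTop F → IsGibbs G χ v (μ : Measure ((ℓ : L) → Loop M)) :=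
    fun μ hμ => isGibbs_of_mapClusterPt G χ hvsymm hvsymm' x hF hμ
  obtain ⟨μ, -, hμ⟩ := hcompact.exists_mapClusterPt (f := atTop) (u := F)
    (tendsto_principal.2 (Eventually.of_forall fun Λ => subset_closure ⟨Λ, rfl⟩))
  exact ⟨⟨F, hF, hcompact, hgibbs⟩, μ, hgibbs μ hμ⟩

end
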